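/- arXiv:2601.09447 — 2 statements merged into one kernel-verified Lean document; each statement's English description precedes it below -/
import Mathlib

section
/- (Cohen–Blum) For every integer n ≥ 1, there exists a shortest sequence of flips transforming Ī_n = [-1, -2, ..., -n] into I_n = [1, 2, ..., n] (i.e., a sorting sequence of length exactly T(n)) whose first flip is the flip of the entire stack, that is, a flip of all n pancakes. -/
/-- The flip of the top `k` pancakes of a burnt pancake stack `l`. -/
def pancakeFlip (k : ℕ) (l : List ℤ) : List ℤ :=
  ((l.take k).map Neg.neg).reverse ++ l.drop k

/-- Apply a sequence of flips (given by their sizes) successively to a stack. -/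
def applyFlips (ks : List ℕ) (l : List ℤ) : List ℤ :=
  ks.foldl (fun s k => pancakeFlip k s) l

/-- The sorted stack `I_n = [1, 2, ..., n]`. -/
def sortedStack (n : ℕ) : List ℤ := (List.range n).map (fun i => (i : ℤ) + 1)

/-- The reversed burnt stack `Ī_n = [-1, -2, ..., -n]`. -/
def burntStack (n : ℕ) : List ℤ := (List.range n).map (fun i => -((i : ℤ) + 1))

/-- A sequence of flips, each of size between `1` and `n`, transforming `Ī_n` into `I_n`. -/
def IsSortingSeq (n : ℕ) (ks : List ℕ) : Prop :=
  (∀ k ∈ ks, 1 ≤ k ∧ k ≤ n) ∧ applyFlips ks (burntStack n) = sortedStack n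

/-- `T n` is the minimum number of flips transforming `Ī_n` into `I_n`. -/
noncomputable def T (n : ℕ) : ℕ :=
  sInf {m | ∃ ks : List ℕ, IsSortingSeq n ks ∧ ks.length = m}

theorem length_pancakeFlip (k : ℕ) (l : List ℤ) : (pancakeFlip k l).length = l.length := by
  simp only [pancakeFlip, List.length_append, List.length_reverse, List.length_map,
    List.length_take, List.length_drop]
  omega

theorem pancakeFlip_append {k : ℕ} {xs : List ℤ} (h : k ≤ xs.length) (ys : List ℤ) :
    pancakeFlip k (xs ++ ys) = pancakeFlip k xs ++ ys := by
  simp [pancakeFlip, List.take_append_of_le_length h, List.drop_append_of_le_length h]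

theorem pancakeFlip_length (xs : List ℤ) :
    pancakeFlip xs.length xs = (xs.map Neg.neg).reverse := by
  simp [pancakeFlip]

theorem pancakeFlip_pancakeFlip {k : ℕ} {l : List ℤ} (h : k ≤ l.length) :
    pancakeFlip k (pancakeFlip k l) = l := by
  obtain ⟨xs, ys, rfl, rfl⟩ : ∃ xs ys, l = xs ++ ys ∧ k = xs.length :=
    ⟨l.take k, l.drop k, by simp, by simp [h]⟩
  rw [pancakeFlip_append le_rfl, pancakeFlip_append (length_pancakeFlip _ _).ge, pancakeFlip_length]
  simp [pancakeFlip, List.take_of_length_le, List.drop_eq_nil_of_le]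

theorem pancakeFlip_map {f : ℤ → ℤ} (hf : ∀ x, f (-x) = -f x) (k : ℕ) (l : List ℤ) :
    pancakeFlip k (l.map f) = (pancakeFlip k l).map f := by
  simp [pancakeFlip, ← List.map_take, Function.comp_def, hf]

theorem applyFlips_append (as bs : List ℕ) (l : List ℤ) :
    applyFlips (as ++ bs) l = applyFlips bs (applyFlips as l) :=
  List.foldl_append

theorem length_applyFlips (ks : List ℕ) (l : List ℤ) : (applyFlips ks l).length = l.length := by
  induction ks generalizing l with
  | nil => rfl
  | cons k ks ih => exact (ih _).trans (length_pancakeFlip k l)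

theorem applyFlips_map {f : ℤ → ℤ} (hf : ∀ x, f (-x) = -f x) (ks : List ℕ) (l : List ℤ) :
    applyFlips ks (l.map f) = (applyFlips ks l).map f := by
  induction ks generalizing l with
  | nil => rfl
  | cons k ks ih =>
    change applyFlips ks (pancakeFlip k (l.map f)) = _
    rw [pancakeFlip_map hf, ih]
    rfl

theorem applyFlips_append_right {ks : List ℕ} {xs : List ℤ} (h : ∀ k ∈ ks, k ≤ xs.length)
    (ys : List ℤ) : applyFlips ks (xs ++ ys) = applyFlips ks xs ++ ys := by
  induction ks generalizing xs with
  | nil => rfl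
  | cons k ks ih =>
    change applyFlips ks (pancakeFlip k (xs ++ ys)) = applyFlips ks (pancakeFlip k xs) ++ ys
    rw [pancakeFlip_append (h k (by simp)), ih]
    intro j hj
    rw [length_pancakeFlip]
    exact h j (by simp [hj])

theorem applyFlips_applyFlips_reverse {ks : List ℕ} {l : List ℤ} (h : ∀ k ∈ ks, k ≤ l.length) :
    applyFlips ks (applyFlips ks.reverse l) = l := by
  induction ks with
  | nil => rfl
  | cons k ks ih =>
    rw [List.reverse_cons, applyFlips_append]
    change applyFlips ks (pancakeFlip k (pancakeFlip k (applyFlips ks.reverse l))) = l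
    rw [pancakeFlip_pancakeFlip (by rw [length_applyFlips]; exact h k (by simp))]
    exact ih fun j hj => h j (by simp [hj])

theorem map_neg_burntStack (n : ℕ) : (burntStack n).map Neg.neg = sortedStack n := by
  simp [burntStack, sortedStack]

theorem length_burntStack (n : ℕ) : (burntStack n).length = n := by
  simp [burntStack]

/-- Every stack of `n` entries is a relabelling of `Ī_n` compatible with turning pancakes over. -/
theorem exists_odd_map_burntStack {n : ℕ} {l : List ℤ} (hl : l.length = n) :
    ∃ f : ℤ → ℤ, (∀ x, f (-x) = -f x) ∧ l = (burntStack n).map f := by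
  refine ⟨fun x => -(x.sign * l.getD (x.natAbs - 1) 0), fun x => by simp, ?_⟩
  apply List.ext_getElem
  · simp [hl, length_burntStack]
  · intro i hi _
    have hs : (-1 + -(i : ℤ)).sign = -1 := Int.sign_eq_neg_one_of_neg (by omega)
    have ha : (-1 + -(i : ℤ)).natAbs - 1 = i := by omega
    simp [burntStack, ← List.map_eq_flatMap, hs, ha, hi]

/-- A sorting sequence for `Ī_n` turns over every entry of every stack in place. -/
theorem applyFlips_eq_map_neg {n : ℕ} {ks : List ℕ}
    (h : applyFlips ks (burntStack n) = sortedStack n) {l : List ℤ} (hl : l.length = n) :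
    applyFlips ks l = l.map Neg.neg := by
  obtain ⟨f, hf, rfl⟩ := exists_odd_map_burntStack hl
  rw [applyFlips_map hf, h, ← map_neg_burntStack]
  simp [Function.comp_def, hf]

/-- The flips of sizes `k`, `1`, `k` turn over only the entry in position `k`. -/
theorem exists_applyFlips_eq_map_neg (l : List ℤ) :
    ∃ ks : List ℕ, (∀ k ∈ ks, 1 ≤ k ∧ k ≤ l.length) ∧ applyFlips ks l = l.map Neg.neg := by
  induction l using List.reverseRecOn with
  | nil => exact ⟨[], by simp, rfl⟩
  | append_singleton xs x ih =>
    obtain ⟨ks, hks, h⟩ := ih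
    refine ⟨ks ++ [xs.length + 1, 1, xs.length + 1], ?_, ?_⟩
    · intro k hk
      rw [List.length_append, List.length_singleton]
      rcases List.mem_append.mp hk with hk | hk
      · have := hks k hk
        omega
      · simp only [List.mem_cons, List.not_mem_nil, or_false] at hk
        omega
    · rw [applyFlips_append, applyFlips_append_right fun k hk => (hks k hk).2, h]
      simp [applyFlips, pancakeFlip, List.take_of_length_le, List.drop_eq_nil_of_le]

theorem exists_isSortingSeq (n : ℕ) : ∃ ks, IsSortingSeq n ks := by
  obtain ⟨ks, hks, h⟩ := exists_applyFlips_eq_map_neg (burntStack n)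
  rw [length_burntStack] at hks
  exact ⟨ks, hks, h.trans (map_neg_burntStack n)⟩

/-- Sorting sequences for `Ī_n` are closed under cyclic rotation. -/
theorem IsSortingSeq.append_comm {n : ℕ} {as bs : List ℕ} (h : IsSortingSeq n (as ++ bs)) :
    IsSortingSeq n (bs ++ as) := by
  refine ⟨fun k hk => h.1 k (by simpa [or_comm] using hk), ?_⟩
  have hinv : applyFlips as (applyFlips as.reverse (burntStack n)) = burntStack n :=
    applyFlips_applyFlips_reverse fun k hk => by
      rw [length_burntStack]
      exact (h.1 k (by simp [hk])).2
  have hneg := applyFlips_eq_map_neg h.2 (l := applyFlips as.reverse (burntStack n))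
    (by rw [length_applyFlips, length_burntStack])
  rw [applyFlips_append, hinv] at hneg
  rw [applyFlips_append, hneg, applyFlips_map (fun _ => rfl), hinv, map_neg_burntStack]

/-- A sorting sequence for `Ī_n` must flip the whole stack, to turn over the bottom pancake. -/
theorem IsSortingSeq.mem {n : ℕ} (hn : 1 ≤ n) {ks : List ℕ} (h : IsSortingSeq n ks) : n ∈ ks := by
  by_contra hmem
  have hlen : ∀ k ∈ ks, k ≤ (List.replicate (n - 1) (0 : ℤ)).length := by
    intro k hk
    have := (h.1 k hk).2
    have : k ≠ n := fun e => hmem (e ▸ hk)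
    rw [List.length_replicate]
    omega
  have hneg := applyFlips_eq_map_neg h.2 (l := List.replicate (n - 1) 0 ++ [1])
    (by simp; omega)
  rw [applyFlips_append_right hlen, List.map_append] at hneg
  have := (List.append_inj' hneg rfl).2
  simp at this

/-- (Cohen–Blum) For every `n ≥ 1` there is a shortest sorting sequence for `Ī_n`
whose first flip is the flip of the entire stack. -/
theorem exists_shortest_starting_with_full_flip (n : ℕ) (hn : 1 ≤ n) :
    ∃ ks : List ℕ, IsSortingSeq n ks ∧ ks.length = T n ∧ ks.head? = some n := by
  obtain ⟨ks, hks, hlen⟩ : T n ∈ {m | ∃ ks : List ℕ, IsSortingSeq n ks ∧ ks.length = m} :=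
    Nat.sInf_mem ((exists_isSortingSeq n).imp' List.length fun ks h => ⟨ks, h, rfl⟩)
  obtain ⟨as, bs, rfl⟩ := List.append_of_mem (hks.mem hn)
  refine ⟨n :: bs ++ as, hks.append_comm, ?_, rfl⟩
  rw [← hlen, List.length_append, List.length_append, Nat.add_comm]
end

section
/- Let n be a positive integer and let P be a burnt pancake stack of size n (a signed permutation list) that contains a clan of size at least 3, i.e., a contiguous sublist of the form [x, x-1, x-2] for some integer x. Then P cannot be sorted to I_n = [1, 2, ..., n] without waste: every sequence of flips transforming P into I_n contains at least one flip that is a waste (equivalently, there is no sequence of flips, each of which is an improve, transforming P into I_n). -/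
/-- The adjacency count of a stack `l` of size `n`: the number of consecutive pairs in
`l ++ [n+1]` where the second entry equals the first entry plus one. -/
def adjCount (n : ℕ) (l : List ℤ) : ℕ :=
  ((l ++ [(n : ℤ) + 1]).zip (l ++ [(n : ℤ) + 1]).tail).countP (fun p => p.2 == p.1 + 1)

/-- The number of consecutive pairs of a list whose second entry is the first plus one. -/
def succPairs (L : List ℤ) : ℕ :=
  (L.zip L.tail).countP (fun p => p.2 == p.1 + 1)

theorem succPairs_singleton (a : ℤ) : succPairs [a] = 0 := by
  simp [succPairs]

theorem succPairs_cons_cons (a b : ℤ) (L : List ℤ) :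
    succPairs (a :: b :: L) = succPairs (b :: L) + (if b = a + 1 then 1 else 0) := by
  simp [succPairs, List.countP_cons]

theorem succPairs_append_cons_cons (L : List ℤ) (a b : ℤ) (M : List ℤ) :
    succPairs (L ++ a :: b :: M) =
      succPairs (L ++ [a]) + (if b = a + 1 then 1 else 0) + succPairs (b :: M) := by
  induction L with
  | nil => simp [succPairs_cons_cons, succPairs_singleton, add_comm]
  | cons c L ih =>
    cases L with
    | nil => simp [succPairs_cons_cons, succPairs_singleton]; omega
    | cons d L =>
      simp only [List.cons_append, succPairs_cons_cons] at ih ⊢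
      omega

theorem succPairs_reverse_map_neg (L : List ℤ) :
    succPairs ((L.map Neg.neg).reverse) = succPairs L := by
  induction L with
  | nil => rfl
  | cons a L ih =>
    cases L with
    | nil => simp [succPairs_singleton]
    | cons b L =>
      simp only [List.map_cons, List.reverse_cons, List.append_assoc, List.cons_append,
        List.nil_append] at ih ⊢
      rw [succPairs_append_cons_cons, ih, succPairs_cons_cons, succPairs_singleton]
      have : (-a = -b + 1) ↔ (b = a + 1) := by constructor <;> intro h <;> omega
      simp [this]

/-- If flipping the prefix `a :: A` increases the number of adjacencies, then the flip creates
an adjacency at the cut. -/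
theorem eq_of_succPairs_lt (a b : ℤ) (A B : List ℤ)
    (h : succPairs (a :: A ++ b :: B) <
      succPairs (((a :: A).map Neg.neg).reverse ++ b :: B)) : b = 1 - a := by
  by_contra hb
  have h1 : ((((a :: A).map Neg.neg).reverse) ++ b :: B) =
      (A.map Neg.neg).reverse ++ (-a) :: b :: B := by simp
  have h2 : (A.map Neg.neg).reverse ++ [-a] = ((a :: A).map Neg.neg).reverse := by simp
  rw [h1, succPairs_append_cons_cons, h2, succPairs_reverse_map_neg,
    if_neg (by omega)] at h
  obtain ⟨A', c, hc⟩ : ∃ A' c, a :: A = A' ++ [c] :=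
    ⟨_, _, (List.dropLast_append_getLast (List.cons_ne_nil a A)).symm⟩
  rw [hc, List.append_assoc, List.singleton_append, succPairs_append_cons_cons] at h
  omega

theorem exists_prefix_of_improve {n k : ℕ} {l : List ℤ} (hk : 1 ≤ k) (hl : l ≠ [])
    (h : adjCount n l < adjCount n (pancakeFlip k l)) :
    ∃ a A B, l = a :: A ++ B ∧ pancakeFlip k l = ((a :: A).map Neg.neg).reverse ++ B ∧
      ∃ B', B ++ [(n : ℤ) + 1] = (1 - a) :: B' := by
  obtain ⟨a, A, hA⟩ : ∃ a A, l.take k = a :: A := by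
    apply List.exists_cons_of_ne_nil
    simp [hl]; omega
  have hl' : l = a :: A ++ l.drop k := by rw [← hA, List.take_append_drop]
  have hf : pancakeFlip k l = ((a :: A).map Neg.neg).reverse ++ l.drop k := by
    rw [pancakeFlip, hA]
  refine ⟨a, A, l.drop k, hl', hf, ?_⟩
  obtain ⟨b, B', hB⟩ : ∃ b B', l.drop k ++ [(n : ℤ) + 1] = b :: B' :=
    List.exists_cons_of_ne_nil (by simp)
  have h' : succPairs (l ++ [(n : ℤ) + 1]) < succPairs (pancakeFlip k l ++ [(n : ℤ) + 1]) := h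
  rw [hf] at h'
  nth_rw 1 [hl'] at h'
  rw [List.append_assoc, List.append_assoc, hB] at h'
  rw [hB, eq_of_succPairs_lt a b A B' h']
  exact ⟨B', rfl⟩

/-- A stack of size `n`: a list whose absolute values form a permutation of `1, ..., n`. -/
def IsStack (n : ℕ) (l : List ℤ) : Prop :=
  (l.map fun x => |x|).Perm (sortedStack n)

theorem sortedStack_eq (n : ℕ) :
    sortedStack n = (List.range n).map (fun i : ℕ => (i : ℤ) + 1) := by
  simp only [sortedStack, List.bind_eq_flatMap, List.pure_def,
    ← List.map_eq_flatMap, List.map_map, Function.comp_def]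

theorem sortedStack_pairwise (n : ℕ) : (sortedStack n).Pairwise (· < ·) := by
  rw [sortedStack_eq, List.pairwise_map]
  exact List.pairwise_lt_range.imp (by intro a b h; omega)

theorem IsStack.nodup {n : ℕ} {l : List ℤ} (h : IsStack n l) :
    (l.map fun x => |x|).Nodup :=
  h.nodup_iff.2 ((sortedStack_pairwise n).imp ne_of_lt)

theorem IsStack.abs_bounds {n : ℕ} {l : List ℤ} (h : IsStack n l) {x : ℤ} (hx : x ∈ l) :
    1 ≤ |x| ∧ |x| ≤ n := by
  have := h.mem_iff.1 (List.mem_map_of_mem hx)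
  simp only [sortedStack_eq, List.mem_map, List.mem_range] at this
  obtain ⟨i, hi, hix⟩ := this
  omega

theorem IsStack.pancakeFlip {n : ℕ} {l : List ℤ} (h : IsStack n l) (k : ℕ) :
    IsStack n (pancakeFlip k l) := by
  refine List.Perm.trans ?_ h
  have h1 : (((l.take k).map Neg.neg).reverse.map fun x => |x|).Perm
      ((l.take k).map fun x => |x|) := by
    refine ((List.reverse_perm _).map _).trans ?_
    simp [Function.comp_def]
  rw [_root_.pancakeFlip, List.map_append]
  refine (h1.append_right _).trans ?_
  rw [← List.map_append, List.take_append_drop]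

/-- The flips `ks` sort `l`, each of them being an improve. -/
def ImproveSorts (n : ℕ) : List ℕ → List ℤ → Prop
  | [], l => l = sortedStack n
  | k :: ks, l => 1 ≤ k ∧ adjCount n l < adjCount n (pancakeFlip k l) ∧
      ImproveSorts n ks (pancakeFlip k l)

theorem improveSorts_of_applyFlips {n : ℕ} (ks : List ℕ) (l : List ℤ)
    (hk : ∀ k ∈ ks, 1 ≤ k) (hs : applyFlips ks l = sortedStack n)
    (hi : ∀ i < ks.length,
      adjCount n (applyFlips (ks.take i) l) < adjCount n (applyFlips (ks.take (i + 1)) l)) :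
    ImproveSorts n ks l := by
  induction ks generalizing l with
  | nil => exact hs
  | cons k ks ih =>
    refine ⟨hk k (by simp), by simpa [applyFlips] using hi 0 (by simp), ?_⟩
    refine ih _ (fun j hj => hk j (by simp [hj])) hs fun i h => ?_
    simpa [applyFlips] using hi (i + 1) (by simpa using h)

/-- A stack with a clan of size two on top admits no improve and is not sorted. -/
theorem not_improveSorts_of_top_clan {n : ℕ} {y : ℤ} {M : List ℤ}
    (hM : IsStack n (y :: (y - 1) :: M)) (ks : List ℕ) :
    ¬ ImproveSorts n ks (y :: (y - 1) :: M) := by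
  intro h
  cases ks with
  | nil =>
    have hp := sortedStack_pairwise n
    rw [← show _ = sortedStack n from h] at hp
    simp only [List.pairwise_cons, List.mem_cons] at hp
    have := hp.1 (y - 1) (Or.inl rfl)
    omega
  | cons k ks =>
    obtain ⟨a, A, B, hl, -, B', hB⟩ := exists_prefix_of_improve h.1 (by simp) h.2.1
    simp only [List.cons_append, List.cons.injEq] at hl
    obtain ⟨rfl, hl⟩ := hl
    have hmem : 1 - y ∈ B ++ [(n : ℤ) + 1] := by simp [hB]
    have hb := hM.abs_bounds (x := y - 1) (by simp)
    have hn := hM.nodup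
    rw [List.mem_append, List.mem_singleton] at hmem
    rcases hmem with hmem | hmem
    · have : 1 - y ∈ (y - 1) :: M := by rw [hl]; simp [hmem]
      rcases List.mem_cons.1 this with h1 | h1
      · have : y - 1 = 0 := by omega
        simp [this] at hb
      · simp only [List.map_cons, List.nodup_cons] at hn
        exact hn.2.1 (by rw [abs_sub_comm]; exact List.mem_map_of_mem h1)
    · rw [abs_sub_comm, hmem, abs_of_nonneg (by omega)] at hb
      omega

theorem not_improveSorts_of_clan {n : ℕ} (ks : List ℕ) {l : List ℤ} (hl : IsStack n l)
    {x : ℤ} (hx : [x, x - 1, x - 2] <:+: l) : ¬ ImproveSorts n ks l := by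
  induction ks generalizing l x with
  | nil =>
    intro h
    have hp := (sortedStack_pairwise n).sublist ((h : l = _) ▸ hx.sublist)
    simp at hp
  | cons k ks ih =>
    rintro ⟨hk, hlt, hks⟩
    have hl' := hl.pancakeFlip k
    obtain ⟨a, A, B, hAB, hf, B', hB⟩ :=
      exists_prefix_of_improve hk (by rintro rfl; simp at hx) hlt
    rw [hf] at hks hl'
    obtain ⟨S, R, hSR⟩ := hx
    rw [hAB, List.append_assoc] at hSR
    rw [hAB] at hl
    have hn := hl.nodup
    have hne := fun z hz => (hl.abs_bounds (x := z) hz).1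
    rcases List.append_eq_append_iff.1 hSR with ⟨T, hT, hC⟩ | ⟨T, hT, hC⟩
    · match T, hC with
      | [], hC =>
        refine ih hl' (x := x) ?_ hks
        exact ⟨((a :: A).map Neg.neg).reverse, R, by simp [← hC]⟩
      | [c], hC =>
        -- cut between `x` and `x - 1`
        simp only [List.cons_append, List.nil_append, List.cons.injEq] at hC
        obtain ⟨rfl, rfl⟩ := hC
        simp only [List.cons_append, List.cons.injEq] at hB
        have h2 := hB.1
        have ha : |x - 2| = |a| := by rw [← abs_neg a]; congr 1; omega
        simp [ha] at hn
      | [c, d], hC =>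
        -- cut between `x - 1` and `x - 2`
        simp only [List.cons_append, List.nil_append, List.cons.injEq] at hC
        obtain ⟨rfl, rfl, rfl⟩ := hC
        rw [hT] at hks hl'
        simp only [List.map_append, List.map_cons, List.map_nil, List.reverse_append,
          List.reverse_cons, List.reverse_nil, List.nil_append, List.cons_append] at hks hl'
        have e : -x = -(x - 1) - 1 := by ring
        rw [e] at hks hl'
        exact not_improveSorts_of_top_clan hl' ks hks
      | c :: d :: e :: T, hC =>
        simp only [List.cons_append, List.nil_append, List.cons.injEq] at hC
        obtain ⟨rfl, rfl, rfl, -⟩ := hC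
        refine ih hl' (x := 2 - x) ?_ hks
        refine ⟨(T.map Neg.neg).reverse, (S.map Neg.neg).reverse ++ B, ?_⟩
        rw [hT]
        simp
        omega
    · refine ih hl' (x := x) ?_ hks
      exact ⟨((a :: A).map Neg.neg).reverse ++ T, R, by simp [hC]⟩

/-- A stack containing a clan of size at least `3` cannot be sorted using only improves:
every sequence of flips sorting it to `I_n` contains a flip that does not strictly increase
the adjacency count. -/
theorem no_improve_only_sorting_of_clan (n : ℕ) (hn : 1 ≤ n) (P : List ℤ)
    (hlen : P.length = n)
    (hperm : (P.map fun x => |x|).Perm (sortedStack n))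
    (hclan : ∃ x : ℤ, [x, x - 1, x - 2] <:+: P) :
    ¬ ∃ ks : List ℕ, (∀ k ∈ ks, 1 ≤ k ∧ k ≤ n) ∧
        applyFlips ks P = sortedStack n ∧
        ∀ i < ks.length,
          adjCount n (applyFlips (ks.take i) P) <
            adjCount n (applyFlips (ks.take (i + 1)) P) := by
  rintro ⟨ks, hk, hs, hi⟩
  obtain ⟨x, hx⟩ := hclan
  exact not_improveSorts_of_clan ks hperm hx
    (improveSorts_of_applyFlips ks P (fun k h => (hk k h).1) hs hi)
end
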